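/- arXiv:2008.03141 — 6 statements merged into one kernel-verified Lean document; each statement's English description precedes it below -/
import Mathlib

section
/- Let A : ℝ → ℝ be nondecreasing and Lipschitz with constant L ≥ 0. Then for all a, a′, b, b′, k ∈ ℝ one has ((A(a′) − A(a)) − (A(b′) − A(b))) · sign(a − b + k) ≤ |A(a′) − A(b′)| − |A(a)− A(b)| + 2L|k|. -/
/-- For `A` nondecreasing and Lipschitz with constant `L ≥ 0`, the pointwise
estimate `((A a′ − A a) − (A b′ − A b)) · sign(a − b + k) ≤ |A a′ − A b′| − |A a − A b| + 2L|k|`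
holds for all `a a′ b b′ k`. -/
theorem stmt_1 (A : ℝ → ℝ) (L : ℝ) (hL : 0 ≤ L) (hA : Monotone A)
    (hLip : ∀ x y, |A x - A y| ≤ L * |x - y|) (a a' b b' k : ℝ) :
    ((A a' - A a) - (A b' - A b)) * Real.sign (a - b + k)
      ≤ |A a' - A b'| - |A a - A b| + 2 * L * |k| := by
  have hP := le_abs_self (A a' - A b')
  have hP' := neg_abs_le (A a' - A b')
  have hLk : 0 ≤ L * |k| := mul_nonneg hL (abs_nonneg k)
  have hclose (h : |a - b| ≤ |k|) : |A a - A b| ≤ L * |k| :=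
    (hLip a b).trans (mul_le_mul_of_nonneg_left h hL)
  rcases lt_trichotomy (a - b + k) 0 with hs | hs | hs
  · rw [Real.sign_of_neg hs]
    rcases le_total a b with hab | hab
    · rw [abs_of_nonpos (sub_nonpos.2 (hA hab))]
      linarith
    · have hQ := hclose (by
        rw [abs_of_nonneg (sub_nonneg.2 hab)]
        linarith [neg_abs_le k])
      linarith [le_abs_self (A a - A b)]
  · rw [hs, Real.sign_zero]
    have hQ := hclose (by rw [eq_neg_of_add_eq_zero_left hs, abs_neg])
    linarith [abs_nonneg (A a' - A b')]
  · rw [Real.sign_of_pos hs]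
    rcases le_total b a with hab | hab
    · rw [abs_of_nonneg (sub_nonneg.2 (hA hab))]
      linarith
    · have hQ := hclose (by
        rw [abs_of_nonpos (sub_nonpos.2 hab)]
        linarith [le_abs_self k])
      linarith [neg_abs_le (A a - A b)]
end

section
/- Let d ≥ 1, λ ∈ (0,1), r > 0, and let u, v ∈ L¹(ℝ^d). Then L^r_λ[u] and L^r_λ[v] belong to L¹(ℝ^d), the convolutions u ⋆ L^r_λ[v] and v ⋆ L^r_λ[u] are defined for almost every x ∈ ℝ^d, and (u ⋆ L^r_λ[v])(x) = (v ⋆ L^r_λ[u])(x) for almost every x ∈ ℝ^d. -/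
open MeasureTheory

/-- The regular (tail) part of the fractional Laplacian of order `λ`:
`L^r_λ[g](x) = ∫_{|z|>r} (g(x) − g(x+z)) / |z|^{d+2λ} dz`. -/
noncomputable def fracTail (d : ℕ) (lam r : ℝ)
    (g : EuclideanSpace ℝ (Fin d) → ℝ) (x : EuclideanSpace ℝ (Fin d)) : ℝ :=
  ∫ z in {z : EuclideanSpace ℝ (Fin d) | r < ‖z‖},
    (g x - g (x + z)) / ‖z‖ ^ ((d : ℝ) + 2 * lam)

open scoped Convolution
open ContinuousLinearMap (mul)

section Convolution

variable {G : Type*} [NormedAddCommGroup G] [NormedSpace ℝ G] [FiniteDimensional ℝ G]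
  [MeasurableSpace G] [BorelSpace G] {μ : Measure G} [μ.IsAddHaarMeasure]

/-- Convolution of real-valued functions is commutative. -/
theorem convolution_mul_comm (f g : G → ℝ) :
    f ⋆[mul ℝ ℝ, μ] g = g ⋆[mul ℝ ℝ, μ] f := by
  ext x
  rw [convolution_mul_swap, convolution_mul]
  simp_rw [mul_comm]

/-- The convolution of integrable real-valued functions is associative almost everywhere. -/
theorem MeasureTheory.Integrable.convolution_mul_assoc {f g k : G → ℝ} (hf : Integrable f μ)
    (hg : Integrable g μ) (hk : Integrable k μ) :
    (f ⋆[mul ℝ ℝ, μ] g) ⋆[mul ℝ ℝ, μ] k =ᵐ[μ] f ⋆[mul ℝ ℝ, μ] (g ⋆[mul ℝ ℝ, μ] k) := by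
  filter_upwards [hf.norm.ae_convolution_exists (mul ℝ ℝ)
    (hg.norm.integrable_convolution (mul ℝ ℝ) hk.norm)] with x hx
  exact convolution_assoc (mul ℝ ℝ) (mul ℝ ℝ) (mul ℝ ℝ) (mul ℝ ℝ) (fun a b c => mul_assoc a b c)
    hf.aestronglyMeasurable hg.aestronglyMeasurable hk.aestronglyMeasurable
    (hf.ae_convolution_exists (mul ℝ ℝ) hg)
    (hg.norm.ae_convolution_exists (mul ℝ ℝ) hk.norm) hx

end Convolution

/-- A power of the norm decaying faster than the dimension is integrable away from the origin. -/
theorem integrableOn_inv_norm_rpow {E : Type*} [NormedAddCommGroup E] [NormedSpace ℝ E]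
    [FiniteDimensional ℝ E] [MeasurableSpace E] [BorelSpace E] {μ : Measure E}
    [μ.IsAddHaarMeasure] {r s : ℝ} (hr : 0 < r) (hs : (Module.finrank ℝ E : ℝ) < s) :
    IntegrableOn (fun z : E => (‖z‖ ^ s)⁻¹) {z : E | r < ‖z‖} μ := by
  have hs₀ : 0 ≤ s := (Nat.cast_nonneg _).trans hs.le
  refine (((integrable_one_add_norm hs).const_mul ((r⁻¹ + 1) ^ s)).integrableOn).mono'
    (Measurable.aestronglyMeasurable (by fun_prop)) ?_
  filter_upwards [ae_restrict_mem (measurableSet_lt measurable_const measurable_norm)] with z hz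
  have hz : r < ‖z‖ := hz
  have hz₀ : 0 < ‖z‖ := hr.trans hz
  have hle : 1 + ‖z‖ ≤ (r⁻¹ + 1) * ‖z‖ := by
    have : 1 ≤ r⁻¹ * ‖z‖ := by
      rw [inv_mul_eq_div, one_le_div hr]
      exact hz.le
    linarith
  have hpow : (1 + ‖z‖) ^ s ≤ (r⁻¹ + 1) ^ s * ‖z‖ ^ s := by
    rw [← Real.mul_rpow (by positivity) hz₀.le]
    exact Real.rpow_le_rpow (by positivity) hle hs₀
  rw [Real.norm_of_nonneg (by positivity), Real.rpow_neg (by positivity), ← div_eq_mul_inv,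
    inv_eq_one_div, div_le_div_iff₀ (by positivity) (by positivity), one_mul]
  exact hpow

/-- The kernel `|z|^{-(d+2λ)} 1_{|z|>r}` of the tail of the fractional Laplacian. -/
noncomputable def tailKernel (d : ℕ) (lam r : ℝ) : EuclideanSpace ℝ (Fin d) → ℝ :=
  {z | r < ‖z‖}.indicator fun z => (‖z‖ ^ ((d : ℝ) + 2 * lam))⁻¹

section TailKernel

variable {d : ℕ} {lam r : ℝ}

theorem integrable_tailKernel (hlam : 0 < lam) (hr : 0 < r) :
    Integrable (tailKernel d lam r) := by
  refine (integrableOn_inv_norm_rpow hr ?_).integrable_indicator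
    (measurableSet_lt measurable_const measurable_norm)
  rw [finrank_euclideanSpace_fin]
  linarith

theorem tailKernel_neg (z : EuclideanSpace ℝ (Fin d)) :
    tailKernel d lam r (-z) = tailKernel d lam r z := by
  simp [tailKernel, Set.indicator]

theorem fracTail_eq_integral_mul (g : EuclideanSpace ℝ (Fin d) → ℝ)
    (x : EuclideanSpace ℝ (Fin d)) :
    fracTail d lam r g x = ∫ z, (g x - g (x + z)) * tailKernel d lam r z := by
  rw [fracTail, ← integral_indicator (measurableSet_lt measurable_const measurable_norm)]
  refine integral_congr_ae (Filter.Eventually.of_forall fun z => ?_)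
  by_cases hz : r < ‖z‖ <;> simp [tailKernel, hz, div_eq_mul_inv]

/-- The tail of the fractional Laplacian is a multiple of the identity minus a convolution. -/
theorem fracTail_ae_eq (hlam : 0 < lam) (hr : 0 < r) {g : EuclideanSpace ℝ (Fin d) → ℝ}
    (hg : Integrable g) :
    fracTail d lam r g =ᵐ[volume]
      (∫ z, tailKernel d lam r z) • g - g ⋆[mul ℝ ℝ, volume] tailKernel d lam r := by
  have hk := integrable_tailKernel (d := d) hlam hr
  filter_upwards [hg.ae_convolution_exists (mul ℝ ℝ) hk] with x hx
  have heq (z : EuclideanSpace ℝ (Fin d)) :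
      g (x + z) * tailKernel d lam r (x - (x + z)) = g (x + z) * tailKernel d lam r z := by
    rw [sub_add_cancel_left, tailKernel_neg]
  have hint : Integrable fun z => g (x + z) * tailKernel d lam r z := by
    simpa only [ContinuousLinearMap.mul_apply', heq] using hx.integrable.comp_add_left x
  rw [fracTail_eq_integral_mul]
  simp_rw [sub_mul]
  rw [integral_sub (hk.const_mul _) hint, integral_const_mul]
  simp only [Pi.sub_apply, Pi.smul_apply, smul_eq_mul]
  rw [convolution_mul, ← integral_add_left_eq_self (fun t => g t * tailKernel d lam r (x - t)) x,
    mul_comm]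
  simp_rw [heq]

theorem integrable_fracTail (hlam : 0 < lam) (hr : 0 < r) {g : EuclideanSpace ℝ (Fin d) → ℝ}
    (hg : Integrable g) : Integrable (fracTail d lam r g) :=
  ((hg.smul _).sub (hg.integrable_convolution (mul ℝ ℝ)
    (integrable_tailKernel hlam hr))).congr (fracTail_ae_eq hlam hr hg).symm

theorem convolution_fracTail_ae_eq (hlam : 0 < lam) (hr : 0 < r)
    {f g : EuclideanSpace ℝ (Fin d) → ℝ} (hf : Integrable f) (hg : Integrable g) :
    f ⋆[mul ℝ ℝ, volume] fracTail d lam r g =ᵐ[volume]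
      (∫ z, tailKernel d lam r z) • (f ⋆[mul ℝ ℝ, volume] g) -
        (f ⋆[mul ℝ ℝ, volume] g) ⋆[mul ℝ ℝ, volume] tailKernel d lam r := by
  have hk := integrable_tailKernel (d := d) hlam hr
  rw [convolution_congr _ (Filter.EventuallyEq.refl _ f) (fracTail_ae_eq hlam hr hg)]
  filter_upwards [hf.ae_convolution_exists (mul ℝ ℝ) hg,
    hf.ae_convolution_exists (mul ℝ ℝ) (hg.integrable_convolution (mul ℝ ℝ) hk),
    hf.convolution_mul_assoc hg hk] with x hfg hfgk hassoc
  rw [Pi.sub_apply, hassoc, ← convolution_smul, sub_eq_add_neg, ← neg_one_smul ℝ,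
    ConvolutionExistsAt.distrib_add, convolution_smul (y := (-1 : ℝ))]
  · simp [sub_eq_add_neg]
  · simpa [ConvolutionExistsAt, mul_left_comm] using
      hfg.integrable.const_mul (∫ z, tailKernel d lam r z)
  · simpa [ConvolutionExistsAt] using hfgk.integrable.neg

end TailKernel

/-- For `u, v ∈ L¹(ℝ^d)`, the tails `L^r_λ[u], L^r_λ[v]` are in `L¹`,
the convolutions `u ⋆ L^r_λ[v]` and `v ⋆ L^r_λ[u]` are defined a.e., and they agree a.e. -/
theorem stmt_4 (d : ℕ) (hd : 1 ≤ d) (lam r : ℝ) (hlam : lam ∈ Set.Ioo (0 : ℝ) 1) (hr : 0 < r)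
    (u v : EuclideanSpace ℝ (Fin d) → ℝ)
    (hu : Integrable u volume) (hv : Integrable v volume) :
    Integrable (fracTail d lam r u) volume ∧
    Integrable (fracTail d lam r v) volume ∧
    (∀ᵐ x : EuclideanSpace ℝ (Fin d) ∂volume,
      Integrable (fun y => u (x - y) * fracTail d lam r v y) volume) ∧
    (∀ᵐ x : EuclideanSpace ℝ (Fin d) ∂volume,
      Integrable (fun y => v (x - y) * fracTail d lam r u y) volume) ∧
    (∀ᵐ x : EuclideanSpace ℝ (Fin d) ∂volume,
      ∫ y, u (x - y) * fracTail d lam r v y = ∫ y, v (x - y) * fracTail d lam r u y) := by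
  have hlam₀ := hlam.1
  have exists_conv {f g : EuclideanSpace ℝ (Fin d) → ℝ} (hf : Integrable f) (hg : Integrable g) :
      ∀ᵐ x, Integrable fun y => f (x - y) * g y := by
    filter_upwards [hf.ae_convolution_exists (mul ℝ ℝ) hg] with x hx
    exact hx.integrable_swap
  have hLu := integrable_fracTail hlam₀ hr hu
  have hLv := integrable_fracTail hlam₀ hr hv
  refine ⟨hLu, hLv, exists_conv hu hLv, exists_conv hv hLu, ?_⟩
  filter_upwards [convolution_fracTail_ae_eq hlam₀ hr hu hv,
    convolution_fracTail_ae_eq hlam₀ hr hv hu] with x huv hvu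
  rw [← convolution_mul_swap, ← convolution_mul_swap, huv, hvu, convolution_mul_comm u v]
end

section
/- Let η : ℝ → ℝ be differentiable and convex, let A : ℝ → ℝ be continuously differentiable with A′(σ) ≥ 0 for all σ, and for k ∈ ℝ set A^η_k(a) := ∫_k^a η′(σ − k) A′(σ) dσ. Then for all a, b, k ∈ ℝ: (A(a) − A(b)) · η′(a − k) ≥ A^η_k(a) − A^η_k(b) ≥ (A(a) − A(b)) · η′(b − k). -/
open intervalIntegral

theorem Monotone.intervalIntegrable_mul_deriv {g A : ℝ → ℝ} (hg : Monotone g)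
    (hA : ContDiff ℝ 1 A) (a b : ℝ) :
    IntervalIntegrable (fun σ => g σ * deriv A σ) MeasureTheory.volume a b :=
  hg.intervalIntegrable.mul_continuousOn hA.continuous_deriv_one.continuousOn

/-- The integral of `g A'` from `b` to `a`, with `g` and `A` monotone, is at most the increment
of `A` times the value of `g` at the upper endpoint, whatever the order of `a` and `b`. -/
theorem Monotone.integral_mul_deriv_le {g A : ℝ → ℝ} (hg : Monotone g)
    (hA : ContDiff ℝ 1 A) (hA' : ∀ σ, 0 ≤ deriv A σ) (a b : ℝ) :
    ∫ σ in b..a, g σ * deriv A σ ≤ (A a - A b) * g a := by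
  have hint : ∀ x y, IntervalIntegrable (fun σ => g a * deriv A σ) MeasureTheory.volume x y :=
    fun x y => (hA.continuous_deriv_one.const_mul (g a)).intervalIntegrable x y
  have hconst : ∫ σ in b..a, g a * deriv A σ = (A a - A b) * g a := by
    rw [integral_const_mul, integral_deriv_eq_sub
      (fun x _ => hA.differentiable_one x)
      (hA.continuous_deriv_one.intervalIntegrable b a), mul_comm]
  rw [← hconst]
  rcases le_total b a with h | h
  · exact integral_mono_on h (hg.intervalIntegrable_mul_deriv hA b a) (hint b a)
      fun x hx => mul_le_mul_of_nonneg_right (hg hx.2) (hA' x)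
  · rw [integral_symm a b, integral_symm a b, neg_le_neg_iff]
    exact integral_mono_on h (hint a b) (hg.intervalIntegrable_mul_deriv hA a b)
      fun x hx => mul_le_mul_of_nonneg_right (hg hx.1) (hA' x)

/-- For `η` differentiable convex and `A` continuously differentiable with
`A′ ≥ 0`, setting `A^η_k(a) = ∫_k^a η′(σ − k) A′(σ) dσ`, one has the sandwich inequality
`(A(a) − A(b)) η′(a − k) ≥ A^η_k(a) − A^η_k(b) ≥ (A(a) − A(b)) η′(b − k)`. -/
theorem stmt_8 (η A : ℝ → ℝ) (hη : Differentiable ℝ η) (hconv : ConvexOn ℝ Set.univ η)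
    (hA : ContDiff ℝ 1 A) (hA' : ∀ σ, 0 ≤ deriv A σ) (a b k : ℝ) :
    (A a - A b) * deriv η (a - k)
        ≥ (∫ σ in k..a, deriv η (σ - k) * deriv A σ)
            - (∫ σ in k..b, deriv η (σ - k) * deriv A σ) ∧
    (∫ σ in k..a, deriv η (σ - k) * deriv A σ)
        - (∫ σ in k..b, deriv η (σ - k) * deriv A σ)
      ≥ (A a - A b) * deriv η (b - k) := by
  have hg : Monotone fun σ => deriv η (σ - k) := fun x y hxy =>
    hconv.monotoneOn_deriv (fun x _ => hη x) (Set.mem_univ _) (Set.mem_univ _)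
      (sub_le_sub_right hxy k)
  rw [integral_interval_sub_left (hg.intervalIntegrable_mul_deriv hA k a)
    (hg.intervalIntegrable_mul_deriv hA k b)]
  refine ⟨hg.integral_mul_deriv_le hA hA' a b, ?_⟩
  have h := hg.integral_mul_deriv_le hA hA' b a
  rw [integral_symm b a] at h
  linarith
end

section
/- Let δ > 0 and let η : ℝ → ℝ be differentiable, convex, nonnegative, with η(0) = 0, η′(x) = 1 for all x ≥ δ, and η′(x) = −1 for all x ≤ −δ. Let A : ℝ → ℝ be continuously differentiable with 0 ≤ A′(σ) ≤ L for all σ. Then for all a, b ∈ ℝ: | A^η_b(a) − |A(a) − A(b)| | ≤ L·δ, where A^η_b(a) := ∫_b^a η′(σ − b) A′(σ) dσ. -/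
open intervalIntegral

/-- A nonnegative weight integrated against a function with values in `[0, L]`. -/
theorem abs_integral_mul_le_of_mem_Icc {p q L : ℝ} (hpq : p ≤ q) {w g : ℝ → ℝ}
    (hw : IntervalIntegrable w MeasureTheory.volume p q) (hg : Continuous g)
    (hw0 : ∀ x, 0 ≤ w x) (hgL : ∀ x, g x ∈ Set.Icc (0 : ℝ) L) :
    |∫ x in p..q, w x * g x| ≤ L * ∫ x in p..q, w x := by
  rw [abs_of_nonneg (integral_nonneg hpq fun x _ => mul_nonneg (hw0 x) (hgL x).1),
    ← intervalIntegral.integral_const_mul]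
  refine integral_mono_on hpq (hw.mul_continuousOn hg.continuousOn) (hw.const_mul L) fun x _ => ?_
  rw [mul_comm]
  exact mul_le_mul_of_nonneg_right (hgL x).2 (hw0 x)

/-- A nonnegative convex function with slope `1` right of `δ` and slope `-1` left of `-δ`
stays above `|x| - δ`. -/
theorem abs_sub_le_of_convexOn {δ : ℝ} {η : ℝ → ℝ} (hη : Differentiable ℝ η)
    (hconv : ConvexOn ℝ Set.univ η) (hnonneg : ∀ x, 0 ≤ η x)
    (h1 : deriv η δ = 1) (h2 : deriv η (-δ) = -1) (x : ℝ) : |x| - δ ≤ η x := by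
  rw [sub_le_iff_le_add, abs_le']
  constructor
  · rcases le_or_gt x δ with hx | hx
    · linarith [hnonneg x]
    · have h := hconv.deriv_le_slope (Set.mem_univ _) (Set.mem_univ _) hx (hη δ)
      rw [h1, slope_def_field, le_div_iff₀ (sub_pos.2 hx)] at h
      linarith [hnonneg δ]
  · rcases le_or_gt (-δ) x with hx | hx
    · linarith [hnonneg x]
    · have h := hconv.slope_le_deriv (Set.mem_univ _) (Set.mem_univ _) hx (hη (-δ))
      rw [h2, slope_def_field, div_le_iff₀ (sub_pos.2 hx)] at h
      linarith [hnonneg (-δ)]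

/-- With `η` a smooth convex approximation of the absolute value of width `δ`
and `A` continuously differentiable with `0 ≤ A′ ≤ L`, the entropy flux
`A^η_b(a) = ∫_b^a η′(σ − b) A′(σ) dσ` satisfies `| A^η_b(a) − |A(a) − A(b)| | ≤ L δ`. -/
theorem stmt_10 (δ : ℝ) (hδ : 0 < δ) (η : ℝ → ℝ) (hη : Differentiable ℝ η)
    (hconv : ConvexOn ℝ Set.univ η) (hnonneg : ∀ x, 0 ≤ η x) (h0 : η 0 = 0)
    (h1 : ∀ x, δ ≤ x → deriv η x = 1) (h2 : ∀ x, x ≤ -δ → deriv η x = -1)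
    (A : ℝ → ℝ) (L : ℝ) (hA : ContDiff ℝ 1 A) (hA' : ∀ σ, deriv A σ ∈ Set.Icc (0 : ℝ) L)
    (a b : ℝ) :
    abs ((∫ σ in b..a, deriv η (σ - b) * deriv A σ) - |A a - A b|) ≤ L * δ := by
  have hmono : Monotone (deriv η) := fun x y hxy =>
    hconv.monotoneOn_deriv (fun z _ => hη z) (Set.mem_univ x) (Set.mem_univ y) hxy
  have hle (x : ℝ) : deriv η x ≤ 1 :=
    (hmono (le_max_left x δ)).trans_eq (h1 _ (le_max_right _ _))
  have hge (x : ℝ) : -1 ≤ deriv η x :=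
    (h2 _ (min_le_right x _)).symm.trans_le (hmono (min_le_left _ _))
  have hlow := abs_sub_le_of_convexOn hη hconv hnonneg (h1 δ le_rfl) (h2 (-δ) le_rfl) (a - b)
  have hcont : Continuous (deriv A) := hA.continuous_deriv le_rfl
  have hdiff : Differentiable ℝ A := hA.differentiable one_ne_zero
  have hAmono : Monotone A := monotone_of_deriv_nonneg hdiff fun x => (hA' x).1
  have hL : 0 ≤ L := (hA' 0).1.trans (hA' 0).2
  have hint (p q : ℝ) :
      IntervalIntegrable (fun σ => deriv η (σ - b)) MeasureTheory.volume p q :=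
    Monotone.intervalIntegrable fun x y hxy => hmono (sub_le_sub_right hxy b)
  have hprod (p q : ℝ) :
      IntervalIntegrable (fun σ => deriv η (σ - b) * deriv A σ) MeasureTheory.volume p q :=
    (hint p q).mul_continuousOn hcont.continuousOn
  have hηint (p q : ℝ) : ∫ σ in p..q, deriv η (σ - b) = η (q - b) - η (p - b) := by
    rw [integral_comp_sub_right (deriv η) b]
    exact integral_deriv_eq_sub (fun x _ => hη x) hmono.intervalIntegrable
  have hAint (p q : ℝ) : ∫ σ in p..q, deriv A σ = A q - A p :=
    integral_deriv_eq_sub (fun x _ => hdiff x) (hcont.intervalIntegrable p q)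
  rcases le_total b a with hab | hab
  · have key := abs_integral_mul_le_of_mem_Icc (w := fun σ => 1 - deriv η (σ - b)) hab
      (intervalIntegrable_const.sub (hint b a)) hcont (fun x => sub_nonneg.2 (hle _)) hA'
    simp only [sub_mul, one_mul] at key
    rw [integral_sub (hcont.intervalIntegrable b a) (hprod b a), hAint,
      integral_sub intervalIntegrable_const (hint b a), hηint, integral_const, sub_self, h0,
      smul_eq_mul] at key
    rw [abs_of_nonneg (sub_nonneg.2 (hAmono hab)), abs_sub_comm]
    refine key.trans (mul_le_mul_of_nonneg_left ?_ hL)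
    rw [abs_of_nonneg (sub_nonneg.2 hab)] at hlow
    linarith
  · have key := abs_integral_mul_le_of_mem_Icc (w := fun σ => 1 + deriv η (σ - b)) hab
      (intervalIntegrable_const.add (hint a b)) hcont (fun x => by linarith [hge (x - b)]) hA'
    simp only [add_mul, one_mul] at key
    rw [integral_add (hcont.intervalIntegrable a b) (hprod a b), hAint,
      integral_add intervalIntegrable_const (hint a b), hηint, integral_const, sub_self, h0,
      smul_eq_mul] at key
    rw [abs_of_nonpos (sub_nonpos.2 (hAmono hab)), integral_symm, ← abs_neg]
    refine (le_of_eq (congrArg abs ?_)).trans (key.trans (mul_le_mul_of_nonneg_left ?_ hL))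
    · ring
    · rw [abs_of_nonpos (sub_nonpos.2 hab)] at hlow
      linarith
end

section
/- Let η : ℝ → ℝ be twice continuously differentiable with |η′(x)| ≤ 1 and |η″(x)| ≤ M for all x, and let A : ℝ → ℝ be continuously differentiable with |A′(σ)| ≤ L for all σ. For k ∈ ℝ set A^η_k(c) := ∫_k^c η′(σ − k) A′(σ) dσ. Then for all a, b, c ∈ ℝ: |A^η_a(c) − A^η_b(c)| ≤ L |a − b| (1 + M · max(|c − a|, |c − b|)). -/
open intervalIntegral

/-- For `η` twice continuously differentiable with `|η′| ≤ 1`, `|η″| ≤ M`, and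
`A` continuously differentiable with `|A′| ≤ L`, the entropy flux
`A^η_k(c) = ∫_k^c η′(σ − k) A′(σ) dσ` satisfies
`|A^η_a(c) − A^η_b(c)| ≤ L |a − b| (1 + M max(|c − a|, |c − b|))`. -/
theorem stmt_11 (η A : ℝ → ℝ) (M L : ℝ) (hη : ContDiff ℝ 2 η)
    (hη1 : ∀ x, |deriv η x| ≤ 1) (hη2 : ∀ x, |deriv (deriv η) x| ≤ M)
    (hA : ContDiff ℝ 1 A) (hA' : ∀ σ, |deriv A σ| ≤ L) (a b c : ℝ) :
    |(∫ σ in a..c, deriv η (σ - a) * deriv A σ)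
        - ∫ σ in b..c, deriv η (σ - b) * deriv A σ|
      ≤ L * |a - b| * (1 + M * max |c - a| |c - b|) := by
  have hd : ContDiff ℝ 1 (deriv η) := hη.deriv'
  have hcd : Continuous (deriv η) := hd.continuous
  have hcA : Continuous (deriv A) := hA.continuous_deriv le_rfl
  have hL : 0 ≤ L := (abs_nonneg _).trans (hA' 0)
  have hM : 0 ≤ M := (abs_nonneg _).trans (hη2 0)
  have hlip (x y : ℝ) : |deriv η x - deriv η y| ≤ M * |x - y| :=
    convex_univ.norm_image_sub_le_of_norm_deriv_le
      (fun z _ => (hd.differentiable one_ne_zero) z) (fun z _ => hη2 z)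
      (Set.mem_univ y) (Set.mem_univ x)
  have hint (k u v : ℝ) :
      IntervalIntegrable (fun σ => deriv η (σ - k) * deriv A σ) MeasureTheory.volume u v :=
    (by fun_prop : Continuous fun σ => deriv η (σ - k) * deriv A σ).intervalIntegrable u v
  have hsplit : (∫ σ in a..c, deriv η (σ - a) * deriv A σ)
        - ∫ σ in b..c, deriv η (σ - b) * deriv A σ
      = (∫ σ in a..b, deriv η (σ - a) * deriv A σ)
        + ∫ σ in b..c, (deriv η (σ - a) * deriv A σ - deriv η (σ - b) * deriv A σ) := by
    rw [integral_sub (hint a b c) (hint b b c),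
      ← integral_add_adjacent_intervals (hint a a b) (hint a b c)]
    ring
  have hbase : ‖∫ σ in a..b, deriv η (σ - a) * deriv A σ‖ ≤ L * |b - a| := by
    refine norm_integral_le_of_norm_le_const fun σ _ => ?_
    rw [Real.norm_eq_abs, abs_mul]
    simpa using mul_le_mul (hη1 (σ - a)) (hA' σ) (abs_nonneg _) zero_le_one
  have hshift : ‖∫ σ in b..c, (deriv η (σ - a) * deriv A σ - deriv η (σ - b) * deriv A σ)‖
      ≤ M * |a - b| * L * |c - b| := by
    refine norm_integral_le_of_norm_le_const fun σ _ => ?_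
    rw [Real.norm_eq_abs, ← sub_mul, abs_mul]
    have h := hlip (σ - a) (σ - b)
    rw [sub_sub_sub_cancel_left, abs_sub_comm b a] at h
    exact mul_le_mul h (hA' σ) (abs_nonneg _) (by positivity)
  rw [hsplit]
  calc _ ≤ L * |b - a| + M * |a - b| * L * |c - b| :=
        (abs_add_le _ _).trans (add_le_add hbase hshift)
    _ = L * |a - b| * (1 + M * |c - b|) := by rw [abs_sub_comm b a]; ring
    _ ≤ L * |a - b| * (1 + M * max |c - a| |c - b|) := by
        gcongr
        exact le_max_right _ _
end

section
/- Let f : ℝ → ℝ^d be differentiable with f′ Lipschitz of constant M, and define F(a,b) := sign(a − b)·(f(a) − f(b)). Then for all b, k ∈ ℝ the map a ↦ F(a, b − k) − F(a + k, b) is Lipschitz with constant M|k|; that is, for all a, a′ ∈ ℝ, ‖(F(a, b−k) − F(a+k, b)) − (F(a′, b−k) − F(a′+k, b))‖ ≤ M |k| |a − a′|. -/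
/-- The Kruzhkov entropy flux `F(a,b) = sign(a − b) • (f(a) − f(b))`. -/
noncomputable def kruzhkovFlux (d : ℕ) (f : ℝ → EuclideanSpace ℝ (Fin d)) (a b : ℝ) :
    EuclideanSpace ℝ (Fin d) :=
  Real.sign (a - b) • (f a - f b)

/-- Reflecting a Lipschitz function about its value at `c` preserves the Lipschitz constant. -/
theorem norm_sign_smul_sub_sub_le {E : Type*} [NormedAddCommGroup E] [NormedSpace ℝ E]
    {g : ℝ → E} {L : ℝ} (hg : ∀ x y, ‖g x - g y‖ ≤ L * |x - y|) (c x y : ℝ) :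
    ‖Real.sign (x - c) • (g x - g c) - Real.sign (y - c) • (g y - g c)‖ ≤ L * |x - y| := by
  wlog hxy : x ≤ y generalizing x y
  · rw [norm_sub_rev, abs_sub_comm]
    exact this y x (le_of_not_ge hxy)
  rcases lt_or_ge c x with hx | hx
  · rw [Real.sign_of_pos (sub_pos.2 hx), Real.sign_of_pos (sub_pos.2 (hx.trans_le hxy)),
      one_smul, one_smul, sub_sub_sub_cancel_right]
    exact hg x y
  rcases lt_or_ge y c with hy | hy
  · rw [Real.sign_of_neg (sub_neg.2 hy), Real.sign_of_neg (sub_neg.2 (hxy.trans_lt hy)),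
      ← smul_sub, sub_sub_sub_cancel_right, neg_one_smul, norm_neg]
    exact hg x y
  have sign_le (z : ℝ) : ‖Real.sign (z - c) • (g z - g c)‖ ≤ L * |z - c| := by
    refine le_trans ?_ (hg z c)
    rcases Real.sign_apply_eq (z - c) with h | h | h <;> simp [h, norm_sub_rev]
  calc _ ≤ _ := norm_sub_le _ _
    _ ≤ L * |x - c| + L * |y - c| := add_le_add (sign_le x) (sign_le y)
    _ = L * |x - y| := by
      rw [abs_of_nonpos (sub_nonpos.2 hx), abs_of_nonneg (sub_nonneg.2 hy),
        abs_of_nonpos (sub_nonpos.2 hxy)]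
      ring

/-- If `deriv f` is `M`-Lipschitz, then `x ↦ f x - f (x + k)` is `M * |k|`-Lipschitz. -/
theorem norm_sub_translate_sub_le {E : Type*} [NormedAddCommGroup E] [NormedSpace ℝ E]
    {f : ℝ → E} {M : ℝ} (hf : Differentiable ℝ f)
    (hf' : ∀ x y, ‖deriv f x - deriv f y‖ ≤ M * |x - y|) (k x y : ℝ) :
    ‖(f x - f (x + k)) - (f y - f (y + k))‖ ≤ M * |k| * |x - y| := by
  refine convex_univ.norm_image_sub_le_of_norm_hasDerivWithin_le
    (f := fun z => f z - f (z + k)) (f' := fun z => deriv f z - deriv f (z + k))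
    (fun z _ => ?_) (fun z _ => ?_) (Set.mem_univ y) (Set.mem_univ x)
  · exact ((hf z).hasDerivAt.sub ((hf (z + k)).hasDerivAt.comp_add_const z k)).hasDerivWithinAt
  · simpa using hf' z (z + k)

/-- If `f : ℝ → ℝ^d` is differentiable with `f′` Lipschitz of constant `M`,
then for all `b, k` the map `a ↦ F(a, b − k) − F(a + k, b)` is Lipschitz with
constant `M |k|`. -/
theorem stmt_13 (d : ℕ) (f : ℝ → EuclideanSpace ℝ (Fin d)) (M : ℝ)
    (hf : Differentiable ℝ f) (hf' : ∀ x y, ‖deriv f x - deriv f y‖ ≤ M * |x - y|)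
    (b k a a' : ℝ) :
    ‖(kruzhkovFlux d f a (b - k) - kruzhkovFlux d f (a + k) b)
        - (kruzhkovFlux d f a' (b - k) - kruzhkovFlux d f (a' + k) b)‖
      ≤ M * |k| * |a - a'| := by
  have flux_sub (x : ℝ) : kruzhkovFlux d f x (b - k) - kruzhkovFlux d f (x + k) b =
      Real.sign (x - (b - k)) • ((f x - f (x + k)) - (f (b - k) - f (b - k + k))) := by
    rw [kruzhkovFlux, kruzhkovFlux, sub_add_cancel, show x + k - b = x - (b - k) by ring,
      ← smul_sub, sub_sub_sub_comm]
  rw [flux_sub, flux_sub]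
  exact norm_sign_smul_sub_sub_le (g := fun x => f x - f (x + k))
    (norm_sub_translate_sub_le hf hf' k) (b - k) a a'
end
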